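/- arXiv:1909.04982 — 2 statements merged into one kernel-verified Lean document; each statement's English description precedes it below -/
import Mathlib

section
/- For every integer k ≥ 4 and every positive integer n, n is a sum of k nonzero generalized pentagonal numbers if and only if n ≥ k. Equivalently: there exist nonzero integers x₁, …, x_k with n = Σᵢ (3xᵢ² − xᵢ)/2 if and only if n ∉ {1, 2, …, k−1}. -/
/-- A positive definite binary integral form of determinant `D` properly represents a value
at most `√(4D/3)`. -/
lemma exists_small_value_binary (a b c : ℤ) (ha : 0 < a) (hD : 0 < a * c - b ^ 2) :
    ∃ p q r s : ℤ, p * s - q * r = 1 ∧ 0 < a * p ^ 2 + 2 * b * p * r + c * r ^ 2 ∧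
      3 * (a * p ^ 2 + 2 * b * p * r + c * r ^ 2) ^ 2 ≤ 4 * (a * c - b ^ 2) := by
  induction h : a.toNat using Nat.strong_induction_on generalizing a b c with
  | _ N ih =>
  obtain ⟨t, ht₁, ht₂⟩ : ∃ t : ℤ, 2 * (b + t * a) ≤ a ∧ -a ≤ 2 * (b + t * a) := by
    refine ⟨-((2 * b + a) / (2 * a)), ?_, ?_⟩ <;>
    nlinarith [Int.emod_add_mul_ediv (2 * b + a) (2 * a),
      Int.emod_nonneg (2 * b + a) (show 2 * a ≠ 0 by lia),
      Int.emod_lt_of_pos (2 * b + a) (show 0 < 2 * a by lia)]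
  set b' := b + t * a with hb'
  set c' := c + 2 * t * b + t ^ 2 * a with hc'
  have hD' : a * c' - b' ^ 2 = a * c - b ^ 2 := by rw [hb', hc']; ring
  have hbsq : 4 * b' ^ 2 ≤ a ^ 2 := by nlinarith
  have hc'pos : 0 < c' := by
    by_contra! hneg
    nlinarith [sq_nonneg b']
  by_cases hlt : c' < a
  · obtain ⟨p, q, r, s, hdet, hpos, hle⟩ :=
      ih c'.toNat (by lia) c' (-b') a hc'pos (by linarith [hD']) rfl
    have hval : a * (t * p - r) ^ 2 + 2 * b * (t * p - r) * p + c * p ^ 2 =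
        c' * p ^ 2 + 2 * (-b') * p * r + a * r ^ 2 := by rw [hb', hc']; ring
    refine ⟨t * p - r, t * q - s, p, q, by linarith, by rw [hval]; exact hpos, ?_⟩
    rw [hval]
    linarith
  · refine ⟨1, 0, 0, 1, by ring, by linarith, ?_⟩
    nlinarith

lemma lt_of_three_mul_sq_le {a b g : ℤ} (ha : 2 ≤ a) (hg : 4 * g ^ 2 ≤ a ^ 2)
    (hle : 3 * (a * b - g ^ 2) ^ 2 ≤ 4 * a) : b < a := by
  by_contra! hge
  have hab : a * a ≤ a * b := mul_le_mul_of_nonneg_left hge (by lia)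
  have h₁ : 3 * a ^ 2 ≤ 4 * (a * b - g ^ 2) := by linarith
  have h₂ : (3 * a ^ 2) ^ 2 ≤ (4 * (a * b - g ^ 2)) ^ 2 := pow_le_pow_left₀ (by positivity) h₁ 2
  have h₃ : 2 ^ 3 * a ≤ a ^ 3 * a :=
    mul_le_mul_of_nonneg_right (pow_le_pow_left₀ (by norm_num) ha 3) (by lia)
  linarith

/-- An integral ternary quadratic form that is positive definite of determinant one takes only
values that are sums of three squares. -/
lemma unimodular_ternary_eq_sum_three_sq (a b c d e g : ℤ) (ha : 0 < a) (hm : 0 < a * b - g ^ 2)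
    (hdet : a * b * c + 2 * d * e * g - a * d ^ 2 - b * e ^ 2 - c * g ^ 2 = 1) (x y z : ℤ) :
    ∃ u v w : ℤ, a * x ^ 2 + b * y ^ 2 + c * z ^ 2 + 2 * d * y * z + 2 * e * x * z
      + 2 * g * x * y = u ^ 2 + v ^ 2 + w ^ 2 := by
  induction h : a.toNat using Nat.strong_induction_on generalizing a b c d e g x y z with
  | _ N ih =>
  have hdisc : (a * b - g ^ 2) * (a * c - e ^ 2) - (a * d - g * e) ^ 2 = a := by
    linear_combination a * hdet
  obtain ⟨p, q, r, s, hps, hpos, hle⟩ := exists_small_value_binary (a * b - g ^ 2) (a * d - g * e)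
    (a * c - e ^ 2) hm (by rwa [hdisc])
  rw [hdisc] at hle
  obtain ⟨t, ht₁, ht₂⟩ : ∃ t : ℤ, 2 * (g * p + e * r + t * a) ≤ a ∧
      -a ≤ 2 * (g * p + e * r + t * a) := by
    generalize g * p + e * r = k
    refine ⟨-((2 * k + a) / (2 * a)), ?_, ?_⟩ <;>
    nlinarith [Int.emod_add_mul_ediv (2 * k + a) (2 * a),
      Int.emod_nonneg (2 * k + a) (show 2 * a ≠ 0 by lia),
      Int.emod_lt_of_pos (2 * k + a) (show 0 < 2 * a by lia)]
  obtain ⟨b', hb'⟩ : ∃ b', b' = b * p ^ 2 + 2 * d * p * r + c * r ^ 2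
    + 2 * t * (g * p + e * r) + t ^ 2 * a := ⟨_, rfl⟩
  obtain ⟨c', hc'⟩ : ∃ c', c' = b * q ^ 2 + 2 * d * q * s + c * s ^ 2 := ⟨_, rfl⟩
  obtain ⟨e', he'⟩ : ∃ e', e' = g * q + e * s := ⟨_, rfl⟩
  obtain ⟨g', hg'⟩ : ∃ g', g' = g * p + e * r + t * a := ⟨_, rfl⟩
  obtain ⟨d', hd'⟩ : ∃ d', d' = b * p * q + d * (p * s + q * r) + c * r * s + t * e' := ⟨_, rfl⟩
  have hminor : a * b' - g' ^ 2 = (a * b - g ^ 2) * p ^ 2 + 2 * (a * d - g * e) * p * r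
      + (a * c - e ^ 2) * r ^ 2 := by rw [hb', hg']; ring
  have hdet' : a * b' * c' + 2 * d' * e' * g' - a * d' ^ 2 - b' * e' ^ 2 - c' * g' ^ 2 = 1 := by
    have : a * b' * c' + 2 * d' * e' * g' - a * d' ^ 2 - b' * e' ^ 2 - c' * g' ^ 2 =
        (a * b * c + 2 * d * e * g - a * d ^ 2 - b * e ^ 2 - c * g ^ 2)
          * (p * s - q * r) ^ 2 := by
      rw [hd', hb', hc', hg', he']; ring
    rw [this, hdet, hps]; norm_num
  rw [← hg'] at ht₁ ht₂
  rw [← hminor] at hpos hle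
  have hg'sq : 4 * g' ^ 2 ≤ a ^ 2 := by nlinarith
  obtain ⟨y', hy'⟩ : ∃ y', y' = s * y - q * z := ⟨_, rfl⟩
  obtain ⟨z', hz'⟩ : ∃ z', z' = p * z - r * y := ⟨_, rfl⟩
  obtain ⟨x', hx'⟩ : ∃ x', x' = x - t * y' := ⟨_, rfl⟩
  have hy : y = p * y' + q * z' := by rw [hy', hz']; linear_combination (-y) * hps
  have hz : z = r * y' + s * z' := by rw [hy', hz']; linear_combination (-z) * hps
  have hx : x = x' + t * y' := by rw [hx']; ring
  have hval : a * x ^ 2 + b * y ^ 2 + c * z ^ 2 + 2 * d * y * z + 2 * e * x * z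
      + 2 * g * x * y = b' * y' ^ 2 + a * x' ^ 2 + c' * z' ^ 2 + 2 * e' * x' * z'
        + 2 * d' * y' * z' + 2 * g' * y' * x' := by
    rw [hx, hy, hz, hd', hb', hc', hg', he']; ring
  clear hx hy hz hx' hy' hz' hdet hdisc hps hm hd' hb' hc' he' hg' hminor
  rw [hval]
  have hb'pos : 0 < b' := by
    by_contra! hneg
    nlinarith [sq_nonneg g']
  by_cases ha1 : a = 1
  · clear ih
    subst ha1
    have hg0 : g' = 0 := by lia
    subst hg0
    have hb1 : b' = 1 := by nlinarith
    subst hb1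
    refine ⟨x' + e' * z', y' + d' * z', z', ?_⟩
    linear_combination z' ^ 2 * hdet'
  · have hlt : b' < a := lt_of_three_mul_sq_le (by lia) hg'sq hle
    exact ih b'.toNat (by lia) b' a c' e' d' g' hb'pos (by linarith)
      (by linarith) y' x' z' rfl

open NumberTheorySymbols in
/-- **Gauss**: every natural number congruent to `3` modulo `8` is a sum of three squares. -/
lemma sum_three_sq_of_mod_eight_eq_three (m : ℕ) (hm : m % 8 = 3) :
    ∃ u v w : ℤ, (m : ℤ) = u ^ 2 + v ^ 2 + w ^ 2 := by
  obtain ⟨k, rfl⟩ : ∃ k, m = 2 * k + 1 := ⟨m / 2, by lia⟩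
  have hcop : Nat.Coprime k (4 * (2 * k + 1)) := by
    refine Nat.Coprime.mul_right ?_ (by simp)
    have : Nat.Coprime k (2 ^ 2) := Nat.Coprime.pow_right 2 (Nat.coprime_two_right.mpr
      (Nat.odd_iff.mpr (by lia)))
    simpa using this
  have : NeZero (4 * (2 * k + 1)) := ⟨by lia⟩
  obtain ⟨p, hpk, hp, hmod⟩ := Nat.forall_exists_prime_gt_and_eq_mod
    ((ZMod.isUnit_iff_coprime k (4 * (2 * k + 1))).mpr hcop) k
  obtain ⟨v, hv⟩ : 4 * (2 * k + 1) ∣ p - k :=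
    (Nat.modEq_iff_dvd' hpk.le).mp ((ZMod.natCast_eq_natCast_iff _ _ _).mp hmod).symm
  have hpv : p = k + 4 * (2 * k + 1) * v := by lia
  have hp4 : p % 4 = 1 := by
    rw [hpv, mul_assoc, Nat.add_mul_mod_self_left]; lia
  obtain ⟨b, hb⟩ : ∃ b, b = 8 * v + 1 := ⟨_, rfl⟩
  have hpb : (2 * p : ℤ) = b * (2 * k + 1) - 1 := by
    rw [hpv, hb]; push_cast; ring
  have : Fact p.Prime := ⟨hp⟩
  have hbodd : Odd b := Nat.odd_iff.mpr (by lia)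
  have hpodd : Odd p := Nat.odd_iff.mpr (by lia)
  have hjac : J(-(b : ℤ) | p) = 1 := by
    rw [jacobiSym.neg _ hpodd, ZMod.χ₄_nat_one_mod_four hp4, one_mul,
      jacobiSym.quadratic_reciprocity_one_mod_four' hbodd hp4]
    have h₁ : J(-2 | b) = 1 := by
      rw [jacobiSym.at_neg_two hbodd, ZMod.χ₈'_nat_eq_if_mod_eight]
      have : b % 8 = 1 := by lia
      have : b % 2 = 1 := by lia
      rw [if_neg (by lia), if_pos (by lia)]
    have h₂ : J(-2 * (p : ℤ) | b) = 1 := by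
      rw [← jacobiSym.one_left b]
      apply jacobiSym.mod_left'
      apply Int.ModEq.symm
      rw [Int.modEq_iff_dvd]
      exact ⟨-(2 * k + 1), by linear_combination -hpb⟩
    rwa [jacobiSym.mul_left, h₁, one_mul] at h₂
  obtain ⟨y, hy⟩ : ∃ y : ℤ, (p : ℤ) ∣ y ^ 2 + b := by
    obtain ⟨w, hw⟩ := ZMod.isSquare_of_jacobiSym_eq_one hjac
    refine ⟨w.val, (ZMod.intCast_zmod_eq_zero_iff_dvd _ p).mp ?_⟩
    push_cast at hw ⊢
    rw [ZMod.natCast_zmod_val, sq, ← hw]; ring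
  obtain ⟨x, hx2, hx⟩ : ∃ x : ℤ, x % 2 = 1 ∧ (p : ℤ) ∣ x ^ 2 + b := by
    rcases Int.emod_two_eq_zero_or_one y with h | h
    · refine ⟨y + p, by lia, ?_⟩
      have : (y + p) ^ 2 + (b : ℤ) = (y ^ 2 + b) + p * (2 * y + p) := by ring
      rw [this]
      exact dvd_add hy (dvd_mul_right _ _)
    · exact ⟨y, h, hy⟩
  obtain ⟨c, hc⟩ : (2 * p : ℤ) ∣ x ^ 2 + b := by
    refine IsCoprime.mul_dvd ?_ ?_ hx
    · exact_mod_cast (Nat.isCoprime_iff_coprime.mpr (Nat.coprime_two_left.mpr hpodd))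
    · obtain ⟨j, rfl⟩ : ∃ j, x = 2 * j + 1 := ⟨x / 2, by lia⟩
      exact ⟨2 * j ^ 2 + 2 * j + 4 * v + 1, by rw [hb]; push_cast; ring⟩
  have hbpos : (0 : ℤ) < b := by lia
  have hppos : (0 : ℤ) < p := by exact_mod_cast hp.pos
  obtain ⟨u, w, t, h⟩ := unimodular_ternary_eq_sum_three_sq (2 * p) c (2 * k + 1) 1 0 x
    (by lia) (by linarith) (by linear_combination (-(2 * k + 1) : ℤ) * hc - hpb) 0 0 1
  exact ⟨u, w, t, by push_cast; linarith⟩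

/-- A form of **Cauchy's lemma** in which `3 * a < b ^ 2` forces all summands to be nonzero. -/
lemma exists_nonzero_sum_eq_and_sum_sq_eq (a b : ℤ) (ha : a % 2 = 1) (hb : b % 2 = 1)
    (hlo : 3 * a < b ^ 2) (hhi : b ^ 2 ≤ 4 * a) :
    ∃ x y z w : ℤ, (x ≠ 0 ∧ y ≠ 0 ∧ z ≠ 0 ∧ w ≠ 0) ∧ x + y + z + w = b ∧
      x ^ 2 + y ^ 2 + z ^ 2 + w ^ 2 = a := by
  have odd_sq (s : ℤ) : s ^ 2 % 8 = if s % 2 = 1 then 1 else if s % 4 = 0 then 0 else 4 := by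
    have : s % 8 = 0 ∨ s % 8 = 1 ∨ s % 8 = 2 ∨ s % 8 = 3 ∨ s % 8 = 4 ∨ s % 8 = 5 ∨ s % 8 = 6 ∨
      s % 8 = 7 := by lia
    rw [sq, Int.mul_emod]
    rcases this with h | h | h | h | h | h | h | h <;> rw [h] <;> split_ifs <;> lia
  obtain ⟨u, v, w, huvw⟩ := sum_three_sq_of_mod_eight_eq_three (4 * a - b ^ 2).toNat (by
    have := odd_sq b
    rw [if_pos hb] at this
    lia)
  rw [Int.toNat_of_nonneg (by linarith)] at huvw
  have hodd : u % 2 = 1 ∧ v % 2 = 1 ∧ w % 2 = 1 := by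
    have hb' := odd_sq b
    rw [if_pos hb] at hb'
    have hu := odd_sq u
    have hv := odd_sq v
    have hw := odd_sq w
    split_ifs at hu hv hw <;> lia
  obtain ⟨hu, hv, hw⟩ := hodd
  obtain ⟨w', hww, hsum⟩ : ∃ w' : ℤ, w' ^ 2 = w ^ 2 ∧ (b + u + v + w') % 4 = 0 := by
    by_cases h : (b + u + v + w) % 4 = 0
    · exact ⟨w, rfl, h⟩
    · exact ⟨-w, by ring, by lia⟩
  obtain ⟨x, hx⟩ : ∃ x, b + u + v + w' = 4 * x := ⟨(b + u + v + w') / 4, by lia⟩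
  obtain ⟨i, rfl⟩ : ∃ i, u = 2 * i + 1 := ⟨u / 2, by lia⟩
  obtain ⟨j, rfl⟩ : ∃ j, v = 2 * j + 1 := ⟨v / 2, by lia⟩
  obtain ⟨l, rfl⟩ : ∃ l, w' = 2 * l + 1 := ⟨w' / 2, by lia⟩
  obtain rfl : b = 4 * x - 2 * i - 2 * j - 2 * l - 3 := by lia
  have hsq : x ^ 2 + (x - j - l - 1) ^ 2 + (x - i - l - 1) ^ 2 + (x - i - j - 1) ^ 2 = a := by
    linarith
  refine ⟨x, x - j - l - 1, x - i - l - 1, x - i - j - 1, ?_, by ring, hsq⟩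
  have key (p q r : ℤ) (h₁ : p + q + r = 4 * x - 2 * i - 2 * j - 2 * l - 3)
      (h₂ : p ^ 2 + q ^ 2 + r ^ 2 = a) : False := by
    rw [← h₁, ← h₂] at hlo
    nlinarith [sq_nonneg (p - q), sq_nonneg (q - r), sq_nonneg (p - r)]
  refine ⟨fun h => ?_, fun h => ?_, fun h => ?_, fun h => ?_⟩
  · exact key (x - j - l - 1) (x - i - l - 1) (x - i - j - 1) (by lia)
      (by rw [h] at hsq ⊢; linarith)
  · exact key x (x - i - l - 1) (x - i - j - 1) (by lia) (by rw [h] at hsq; linarith)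
  · exact key x (x - j - l - 1) (x - i - j - 1) (by lia) (by rw [h] at hsq; linarith)
  · exact key x (x - j - l - 1) (x - i - l - 1) (by lia) (by rw [h] at hsq; linarith)

lemma two_mul_pentagonal (x : ℤ) : 2 * ((3 * x ^ 2 - x) / 2) = 3 * x ^ 2 - x := by
  apply Int.mul_ediv_cancel'
  rcases Int.even_or_odd' x with ⟨i, rfl | rfl⟩
  · exact ⟨6 * i ^ 2 - i, by ring⟩
  · exact ⟨6 * i ^ 2 + 5 * i + 1, by ring⟩

lemma one_le_pentagonal {x : ℤ} (hx : x ≠ 0) : 1 ≤ (3 * x ^ 2 - x) / 2 := by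
  have h := two_mul_pentagonal x
  have : x ≤ x ^ 2 := Int.le_self_sq x
  have : 0 < x ^ 2 := by positivity
  lia

/-- The nonzero generalized pentagonal numbers with index of absolute value at most `26`. -/
def pentagonalList : List ℕ :=
  (List.range 26).flatMap fun i => [(i + 1) * (3 * i + 2) / 2, (i + 1) * (3 * i + 4) / 2]

lemma exists_pentagonal_of_mem {m : ℕ} (h : m ∈ pentagonalList) :
    ∃ x : ℤ, x ≠ 0 ∧ (m : ℤ) = (3 * x ^ 2 - x) / 2 := by
  simp only [pentagonalList, List.mem_flatMap, List.mem_range, List.mem_cons, List.not_mem_nil,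
    or_false] at h
  obtain ⟨i, -, rfl | rfl⟩ := h
  · refine ⟨i + 1, by lia, ?_⟩
    push_cast
    congr 1
    ring
  · refine ⟨-(i + 1), by lia, ?_⟩
    push_cast
    congr 1
    ring

/-- Encoding a set of natural numbers by the binary digits of `M`, this is the encoding of its
sumset with the list `L`. -/
def sumsetMask (L : List ℕ) (M : ℕ) : ℕ :=
  L.foldr (fun a m => M <<< a ||| m) 0

lemma exists_add_eq_of_testBit_sumsetMask {L : List ℕ} {M n : ℕ}
    (h : (sumsetMask L M).testBit n) : ∃ a ∈ L, ∃ d, n = a + d ∧ M.testBit d := by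
  induction L with
  | nil => simp [sumsetMask] at h
  | cons a L ih =>
    have h' : (M <<< a ||| sumsetMask L M).testBit n := h
    simp only [Nat.testBit_or, Nat.testBit_shiftLeft, Bool.or_eq_true, Bool.and_eq_true,
      decide_eq_true_eq] at h'
    rcases h' with ⟨hle, hbit⟩ | h'
    · exact ⟨a, by simp, n - a, by lia, hbit⟩
    · obtain ⟨c, hc, hd⟩ := ih h'
      exact ⟨c, by simp [hc], hd⟩

lemma testBit_sumsetMask_pentagonalList : ∀ n < 1000, 4 ≤ n →
    (sumsetMask pentagonalList (sumsetMask pentagonalList (sumsetMask pentagonalList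
      (sumsetMask pentagonalList 1)))).testBit n := by
  decide +kernel

lemma exists_four_mem_pentagonalList (n : ℕ) (hn : n < 1000) (h4 : 4 ≤ n) :
    ∃ a ∈ pentagonalList, ∃ b ∈ pentagonalList, ∃ c ∈ pentagonalList, ∃ d ∈ pentagonalList,
      n = a + b + c + d := by
  obtain ⟨a, ha, i, rfl, hi⟩ :=
    exists_add_eq_of_testBit_sumsetMask (testBit_sumsetMask_pentagonalList n hn h4)
  obtain ⟨b, hb, j, rfl, hj⟩ := exists_add_eq_of_testBit_sumsetMask hi
  obtain ⟨c, hc, k, rfl, hk⟩ := exists_add_eq_of_testBit_sumsetMask hj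
  obtain ⟨d, hd, l, rfl, hl⟩ := exists_add_eq_of_testBit_sumsetMask hk
  have : l = 0 := Nat.testBit_one_eq_true_iff_self_eq_zero.mp hl
  exact ⟨a, ha, b, hb, c, hc, d, hd, by lia⟩

lemma exists_four_pentagonal (n : ℕ) (hn : 4 ≤ n) :
    ∃ x y z w : ℤ, (x ≠ 0 ∧ y ≠ 0 ∧ z ≠ 0 ∧ w ≠ 0) ∧
      (n : ℤ) = (3 * x ^ 2 - x) / 2 + (3 * y ^ 2 - y) / 2 + (3 * z ^ 2 - z) / 2
        + (3 * w ^ 2 - w) / 2 := by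
  by_cases hlt : n < 1000
  · obtain ⟨a, ha, b, hb, c, hc, d, hd, rfl⟩ := exists_four_mem_pentagonalList n hlt hn
    obtain ⟨x, hx, hax⟩ := exists_pentagonal_of_mem ha
    obtain ⟨y, hy, hby⟩ := exists_pentagonal_of_mem hb
    obtain ⟨z, hz, hcz⟩ := exists_pentagonal_of_mem hc
    obtain ⟨w, hw, hdw⟩ := exists_pentagonal_of_mem hd
    exact ⟨x, y, z, w, ⟨hx, hy, hz, hw⟩, by push_cast; rw [hax, hby, hcz, hdw]⟩
  · obtain ⟨r, hr6, hr2, hr3⟩ : ∃ r : ℤ, (0 < r ∧ r < 6) ∧ r % 2 = 1 ∧ (r - n) % 3 = 0 := by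
      have : n % 3 = 0 ∨ n % 3 = 1 ∨ n % 3 = 2 := by lia
      rcases this with h | h | h
      · exact ⟨3, by lia⟩
      · exact ⟨1, by lia⟩
      · exact ⟨5, by lia⟩
    have hex : ∃ j : ℕ, (2 * n : ℤ) < (6 * j + r) * (6 * j + r - 1) := ⟨n, by nlinarith⟩
    classical
    have hspec := Nat.find_spec hex
    have hmin := fun i => Nat.find_min (m := i) hex
    set j := Nat.find hex
    have hj : j ≠ 0 := by
      intro h0
      rw [h0] at hspec
      push_cast at hspec
      nlinarith
    obtain ⟨i, hi⟩ := Nat.exists_eq_succ_of_ne_zero hj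
    have hprev := hmin i (by lia)
    rw [hi] at hspec
    push_cast at hspec
    obtain ⟨b, hb⟩ : ∃ b : ℤ, b = 6 * (i + 1) + r := ⟨_, rfl⟩
    have hsb : (2 * n : ℤ) < b * (b - 1) := by rw [hb]; exact hspec
    have hpb : (b - 6) * (b - 7) ≤ 2 * (n : ℤ) := by rw [hb]; linarith
    have hb45 : 45 ≤ b := by
      by_contra! hlt
      have : 7 ≤ b := by lia
      nlinarith
    obtain ⟨a, ha⟩ : ∃ a : ℤ, 2 * n + b = 3 * a := ⟨(2 * n + b) / 3, by lia⟩
    obtain ⟨x, y, z, w, hne, hs, hq⟩ := exists_nonzero_sum_eq_and_sum_sq_eq a b (by lia) (by lia)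
      (by linarith) (by nlinarith)
    refine ⟨x, y, z, w, hne, ?_⟩
    linarith [two_mul_pentagonal x, two_mul_pentagonal y, two_mul_pentagonal z,
      two_mul_pentagonal w]

lemma exists_sum_pentagonal (k : ℕ) (hk : 4 ≤ k) (n : ℕ) (hn : k ≤ n) :
    ∃ x : Fin k → ℤ, (∀ i, x i ≠ 0) ∧ (n : ℤ) = ∑ i, (3 * x i ^ 2 - x i) / 2 := by
  induction k, hk using Nat.le_induction generalizing n with
  | base =>
    obtain ⟨x, y, z, w, ⟨hx, hy, hz, hw⟩, h⟩ := exists_four_pentagonal n hn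
    refine ⟨![x, y, z, w], fun i => by fin_cases i <;> assumption, ?_⟩
    simpa [Fin.sum_univ_four] using h
  | succ k _ ih =>
    obtain ⟨x, hx, hs⟩ := ih (n - 1) (by lia)
    refine ⟨Fin.cons 1 x, Fin.cases (by simp) (by simpa using hx), ?_⟩
    rw [Fin.sum_univ_succ]
    simp only [Fin.cons_zero, Fin.cons_succ, ← hs]
    lia

/-- For `k ≥ 4`, a positive integer `n` is a sum of `k` nonzero generalized pentagonal
numbers iff `n ≥ k`. -/
theorem stmt_17 (k : ℕ) (hk : 4 ≤ k) (n : ℕ) (hn : 0 < n) :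
    (∃ x : Fin k → ℤ, (∀ i, x i ≠ 0) ∧
      (n : ℤ) = ∑ i, (3 * x i ^ 2 - x i) / 2) ↔ k ≤ n := by
  refine ⟨fun ⟨x, hx, hs⟩ => ?_, exists_sum_pentagonal k hk n⟩
  have h : ∑ _i : Fin k, (1 : ℤ) ≤ ∑ i, (3 * x i ^ 2 - x i) / 2 :=
    Finset.sum_le_sum fun i _ => one_le_pentagonal (hx i)
  rw [← hs] at h
  simpa using h
end

section
/- For every integer k ≥ 4 and every positive integer n, n is a sum of k nonzero generalized octagonal numbers if and only if n ∉ {1, 2, …, k−1} ∪ {k+b : b ∈ {1, 2, 3, 5, 6, 9, 10, 13, 17}}. That is, there exist nonzero integers x₁, …, x_k with n = Σᵢ (3xᵢ² − 2xᵢ) if and only if n is not one of the listed exceptional values. -/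
/-! ### Ternary forms of determinant one and sums of three squares -/

/-- The ternary quadratic form with Gram matrix `!![a, f, e; f, b, d; e, d, c]`. -/
def ternaryForm (a b c d e f x y z : ℤ) : ℤ :=
  a * x ^ 2 + b * y ^ 2 + c * z ^ 2 + 2 * d * y * z + 2 * e * x * z + 2 * f * x * y

/-- The integer `m` is a sum of three integer squares. -/
def IsSumThreeSquares (m : ℤ) : Prop := ∃ u v w : ℤ, m = u ^ 2 + v ^ 2 + w ^ 2

theorem exists_abs_two_mul_add_mul_le (h g : ℤ) (hg : 0 < g) :
    ∃ k : ℤ, |2 * (h + g * k)| ≤ g := by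
  refine ⟨-((2 * h + g) / (2 * g)), ?_⟩
  have h1 := Int.emod_add_mul_ediv (2 * h + g) (2 * g)
  have h2 := Int.emod_nonneg (2 * h + g) (show 2 * g ≠ 0 by omega)
  have h3 := Int.emod_lt_of_pos (2 * h + g) (show 0 < 2 * g by omega)
  rw [abs_le]
  constructor <;> linarith

/-- A positive definite ternary form with integral Gram matrix of determinant one takes only
values that are sums of three squares. -/
theorem isSumThreeSquares_ternaryForm (a b c d e f : ℤ) (ha : 0 < a) (hG : 0 < a * b - f ^ 2)
    (hdet : a * b * c + 2 * d * e * f - a * d ^ 2 - b * e ^ 2 - c * f ^ 2 = 1) (x y z : ℤ) :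
    IsSumThreeSquares (ternaryForm a b c d e f x y z) := by
  obtain ⟨k, hk⟩ := exists_abs_two_mul_add_mul_le (a * d - e * f) (a * b - f ^ 2) hG
  obtain ⟨l, hl⟩ := exists_abs_two_mul_add_mul_le f a ha
  -- the form after `y ↦ y + k z` and then `x ↦ x + l y`
  obtain ⟨b', hb'⟩ : ∃ b', b' = b + 2 * f * l + a * l ^ 2 := ⟨_, rfl⟩
  obtain ⟨c', hc'⟩ : ∃ c', c' = c + 2 * d * k + b * k ^ 2 := ⟨_, rfl⟩
  obtain ⟨e', he'⟩ : ∃ e', e' = e + f * k := ⟨_, rfl⟩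
  obtain ⟨d', hd'⟩ : ∃ d', d' = d + b * k + e' * l := ⟨_, rfl⟩
  obtain ⟨f', hf'⟩ : ∃ f', f' = f + a * l := ⟨_, rfl⟩
  have hGeq : a * b' - f' ^ 2 = a * b - f ^ 2 := by subst b' f'; ring
  have hHeq : a * d' - e' * f' = (a * d - e * f) + (a * b - f ^ 2) * k := by
    subst d' e' f'; ring
  have hdet' : a * b' * c' + 2 * d' * e' * f' - a * d' ^ 2 - b' * e' ^ 2 - c' * f' ^ 2 = 1 := by
    rw [← hdet]; subst d' e' f' b' c'; ring
  have hval : ternaryForm a b c d e f x y z =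
      ternaryForm a b' c' d' e' f' (x - l * (y - k * z)) (y - k * z) z := by
    simp only [ternaryForm]; subst d' e' f' b' c'; ring
  rw [← hHeq] at hk
  rw [← hf'] at hl
  rw [← hGeq] at hk hG
  rw [hval]
  clear hval hb' hc' hd'
  have hGK : (a * b' - f' ^ 2) * (a * c' - e' ^ 2) = a + (a * d' - e' * f') ^ 2 := by
    linear_combination a * hdet'
  have hK : 0 < a * c' - e' ^ 2 := by
    by_contra! h
    nlinarith [sq_nonneg (a * d' - e' * f')]
  have hb0 : 0 < b' := by
    by_contra! h
    nlinarith [sq_nonneg f']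
  by_cases hswap : b' < a
  · have := isSumThreeSquares_ternaryForm b' a c' e' d' f' hb0 (by linarith)
      (by rw [← hdet']; ring) (y - k * z) (x - l * (y - k * z)) z
    convert this using 1
    simp only [ternaryForm]; ring
  by_cases hswap' : a * c' - e' ^ 2 < a * b' - f' ^ 2
  · have hlt : (a * c' - e' ^ 2).toNat < (a * b - f ^ 2).toNat := by
      rw [← hGeq]; omega
    have := isSumThreeSquares_ternaryForm a c' b' d' f' e' ha hK
      (by rw [← hdet']; ring) (x - l * (y - k * z)) z (y - k * z)
    convert this using 1
    simp only [ternaryForm]; ring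
  push Not at hswap hswap'
  obtain ⟨G, hGdef⟩ : ∃ G, G = a * b' - f' ^ 2 := ⟨_, rfl⟩
  obtain ⟨H, hHdef⟩ : ∃ H, H = a * d' - e' * f' := ⟨_, rfl⟩
  rw [← hGdef] at hk hG hGK hswap'
  rw [← hHdef] at hk hGK
  have hH2 : 4 * H ^ 2 ≤ G ^ 2 := by
    have := sq_le_sq' (by linarith [(abs_le.mp hk).1]) (abs_le.mp hk).2
    linarith
  have hf2 : 4 * f' ^ 2 ≤ a ^ 2 := by
    have := sq_le_sq' (by linarith [(abs_le.mp hl).1]) (abs_le.mp hl).2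
    linarith
  have h1 : 3 * G ^ 2 ≤ 4 * a := by
    have := mul_le_mul_of_nonneg_left hswap' hG.le
    linarith
  have h2 : 3 * a ^ 2 ≤ 4 * G := by
    have := mul_le_mul_of_nonneg_left hswap ha.le
    linarith
  have ha1 : a = 1 := by
    by_contra hne
    have ha2 : 2 ≤ a := by omega
    have hGa : G < a := by
      by_contra! h
      nlinarith
    nlinarith
  subst ha1
  have hf0 : f' = 0 := by
    have := abs_le.mp hl; omega
  have hG1 : G = 1 := by nlinarith
  subst hf0
  have hH0 : H = 0 := by
    have := abs_le.mp hk; omega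
  have hb1 : b' = 1 := by linarith
  have hd0 : d' = 0 := by linarith
  subst hb1 hd0
  have hc1 : c' = e' ^ 2 + 1 := by linarith
  refine ⟨(x - l * (y - k * z)) + e' * z, y - k * z, z, ?_⟩
  simp only [ternaryForm, hc1]; ring
termination_by (a.toNat, (a * b - f ^ 2).toNat)
decreasing_by
  · exact Prod.Lex.left _ _ (by omega)
  · exact Prod.Lex.right _ hlt

/-- If `-b` is a square modulo `b * m - 1`, then `m` is a sum of three squares. -/
theorem isSumThreeSquares_of_dvd (m b r : ℤ) (hb : 0 < b) (hm : 1 < b * m)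
    (h : b * m - 1 ∣ r ^ 2 + b) : IsSumThreeSquares m := by
  obtain ⟨s, hs⟩ := h
  have hs0 : 0 < s := by
    by_contra! h
    nlinarith [sq_nonneg r]
  have := isSumThreeSquares_ternaryForm s (b * m - 1) m 0 1 r hs0 (by linarith)
    (by linear_combination (-m) * hs) 0 0 1
  simpa [ternaryForm] using this

theorem exists_dvd_sq_add_of_jacobiSym {p b : ℕ} (hp : p.Prime) (h : jacobiSym (-(b : ℤ)) p = 1) :
    ∃ r : ℤ, (p : ℤ) ∣ r ^ 2 + b := by
  have := Fact.mk hp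
  rw [← jacobiSym.legendreSym.to_jacobiSym] at h
  have h0 : ((-(b : ℤ) : ℤ) : ZMod p) ≠ 0 := by
    intro h0
    rw [(legendreSym.eq_zero_iff p _).mpr h0] at h
    exact zero_ne_one h
  obtain ⟨r, hr⟩ := (legendreSym.eq_one_iff p h0).mp h
  refine ⟨(r.val : ℤ), (ZMod.intCast_zmod_eq_zero_iff_dvd _ p).mp ?_⟩
  push_cast at hr ⊢
  rw [ZMod.natCast_zmod_val, sq, ← hr]
  ring

theorem isSumThreeSquares_of_mod_four_eq_two (m : ℕ) (hm : m % 4 = 2) :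
    IsSumThreeSquares (m : ℤ) := by
  have hcop : Nat.Coprime (m - 1) (4 * m) := by
    refine Nat.Coprime.mul_right ?_ ?_
    · exact Nat.Coprime.pow_right 2
        (Nat.coprime_two_right.mpr (Nat.odd_iff.mpr (by omega)))
    · exact ((Nat.coprime_self_sub_left (by omega)).mpr (Nat.coprime_one_left m))
  obtain ⟨p, hpgt, hp, hpm⟩ :=
    Nat.forall_exists_prime_gt_and_modEq (4 * m) (q := 4 * m) (a := m - 1) (by omega) hcop
  have hdvd : 4 * m ∣ p - (m - 1) := (Nat.modEq_iff_dvd' (by omega)).mp hpm.symm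
  obtain ⟨j, hj⟩ := hdvd
  have hpj : p + 1 = (4 * j + 1) * m := by
    have : p = 4 * m * j + (m - 1) := by omega
    have h2 : (4 * j + 1) * m = 4 * m * j + m := by ring
    omega
  have hp4 : p % 4 = 1 := by
    have h2 : (4 * j + 1) * m = 4 * (m * j) + m := by ring
    omega
  have hjac : jacobiSym (-((4 * j + 1 : ℕ) : ℤ)) p = 1 := by
    rw [jacobiSym.neg _ (Nat.odd_iff.mpr (by omega)), ZMod.χ₄_nat_one_mod_four hp4, one_mul,
      ← jacobiSym.quadratic_reciprocity_one_mod_four hp4 (Nat.odd_iff.mpr (by omega))]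
    have : jacobiSym (p : ℤ) (4 * j + 1) = jacobiSym (-1) (4 * j + 1) := by
      have hz := congrArg (Nat.cast : ℕ → ℤ) hpj
      push_cast at hz
      exact jacobiSym.mod_left' (Int.modEq_iff_dvd.mpr ⟨m, by push_cast; linarith⟩).symm
    rw [this, jacobiSym.at_neg_one (Nat.odd_iff.mpr (by omega)),
      ZMod.χ₄_nat_one_mod_four (by omega)]
  obtain ⟨r, hr⟩ := exists_dvd_sq_add_of_jacobiSym hp hjac
  have hpz : (p : ℤ) = ((4 * j + 1 : ℕ) : ℤ) * m - 1 := by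
    have : ((p + 1 : ℕ) : ℤ) = (((4 * j + 1) * m : ℕ) : ℤ) := congrArg _ hpj
    push_cast at this ⊢; linarith
  refine isSumThreeSquares_of_dvd m ((4 * j + 1 : ℕ) : ℤ) r (by positivity) ?_ (hpz ▸ hr)
  have := hp.two_le
  omega

theorem isSumThreeSquares_of_mod_eight_eq_three (m : ℕ) (hm : m % 8 = 3) :
    IsSumThreeSquares (m : ℤ) := by
  obtain ⟨t, ht⟩ : ∃ t, m = 2 * t + 1 := ⟨m / 2, by omega⟩
  have hcop : Nat.Coprime t (4 * m) := by
    refine Nat.Coprime.mul_right ?_ ?_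
    · exact Nat.Coprime.pow_right 2
        (Nat.coprime_two_right.mpr (Nat.odd_iff.mpr (by omega)))
    · rw [ht]; simp
  obtain ⟨p, hpgt, hp, hpm⟩ :=
    Nat.forall_exists_prime_gt_and_modEq (4 * m) (q := 4 * m) (a := t) (by omega) hcop
  have hdvd : 4 * m ∣ p - t := (Nat.modEq_iff_dvd' (by omega)).mp hpm.symm
  obtain ⟨j, hj⟩ := hdvd
  have hpj : 2 * p + 1 = (8 * j + 1) * m := by
    have : p = 4 * m * j + t := by omega
    have h2 : (8 * j + 1) * m = 2 * (4 * m * j) + m := by ring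
    omega
  have hp4 : p % 4 = 1 := by
    have h2 : 4 * m * j = 4 * (m * j) := by ring
    omega
  have hjac : jacobiSym (-((8 * j + 1 : ℕ) : ℤ)) p = 1 := by
    rw [jacobiSym.neg _ (Nat.odd_iff.mpr (by omega)), ZMod.χ₄_nat_one_mod_four hp4, one_mul,
      ← jacobiSym.quadratic_reciprocity_one_mod_four hp4 (Nat.odd_iff.mpr (by omega))]
    have h2 : jacobiSym 2 (8 * j + 1) = 1 := by
      rw [jacobiSym.at_two (Nat.odd_iff.mpr (by omega)), ZMod.χ₈_nat_eq_if_mod_eight]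
      have h8 : (8 * j + 1) % 8 = 1 := by omega
      have h9 : (8 * j + 1) % 2 = 1 := by omega
      simp [h8, h9]
    have : jacobiSym (2 * p : ℤ) (8 * j + 1) = jacobiSym (-1) (8 * j + 1) := by
      have hz := congrArg (Nat.cast : ℕ → ℤ) hpj
      push_cast at hz
      exact jacobiSym.mod_left' (Int.modEq_iff_dvd.mpr ⟨m, by push_cast; linarith⟩).symm
    rw [jacobiSym.mul_left, h2, one_mul] at this
    rw [this, jacobiSym.at_neg_one (Nat.odd_iff.mpr (by omega)),
      ZMod.χ₄_nat_one_mod_four (by omega)]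
  obtain ⟨r, hr⟩ := exists_dvd_sq_add_of_jacobiSym hp hjac
  have hpz : 2 * (p : ℤ) = ((8 * j + 1 : ℕ) : ℤ) * m - 1 := by
    have : ((2 * p + 1 : ℕ) : ℤ) = (((8 * j + 1) * m : ℕ) : ℤ) := congrArg _ hpj
    push_cast at this ⊢; linarith
  have hcop2 : IsCoprime (2 : ℤ) p :=
    Int.isCoprime_iff_gcd_eq_one.mpr (Nat.coprime_two_left.mpr
      (Nat.odd_iff.mpr (by omega)))
  obtain ⟨r', hr'odd, hr'⟩ : ∃ r' : ℤ, r' % 2 = 1 ∧ (p : ℤ) ∣ r' ^ 2 + ((8 * j + 1 : ℕ) : ℤ) := by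
    rcases Int.emod_two_eq_zero_or_one r with h | h
    · refine ⟨r + p, by omega, ?_⟩
      have : (r + p) ^ 2 + ((8 * j + 1 : ℕ) : ℤ) =
        (r ^ 2 + ((8 * j + 1 : ℕ) : ℤ)) + p * (2 * r + p) := by ring
      rw [this]
      exact dvd_add hr (dvd_mul_right _ _)
    · exact ⟨r, h, hr⟩
  have h2 : (2 : ℤ) ∣ r' ^ 2 + ((8 * j + 1 : ℕ) : ℤ) := by
    have : r' ^ 2 % 2 = 1 := by rw [pow_two, Int.mul_emod, hr'odd]; rfl
    push_cast
    omega
  refine isSumThreeSquares_of_dvd m ((8 * j + 1 : ℕ) : ℤ) r' (by positivity) ?_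
    (hpz ▸ hcop2.mul_dvd h2 hr')
  have := hp.two_le
  omega

/-! ### Sums of four nonzero generalized octagonal numbers -/

/-- The integer `n` is a sum of four nonzero generalized octagonal numbers. -/
def IsSumFourOctagonal (n : ℤ) : Prop :=
  ∃ x₁ x₂ x₃ x₄ : ℤ, x₁ ≠ 0 ∧ x₂ ≠ 0 ∧ x₃ ≠ 0 ∧ x₄ ≠ 0 ∧
    n = (3 * x₁ ^ 2 - 2 * x₁) + (3 * x₂ ^ 2 - 2 * x₂) + (3 * x₃ ^ 2 - 2 * x₃)
      + (3 * x₄ ^ 2 - 2 * x₄)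

theorem add_pos_of_three_mul_lt_sq {b u v w : ℤ} (hb : 0 < b)
    (h : 3 * (u ^ 2 + v ^ 2 + w ^ 2) < b ^ 2) : 0 < b + u + v + w := by
  by_contra! hle
  nlinarith [sq_nonneg (u - v), sq_nonneg (v - w), sq_nonneg (u - w)]

/-- A form of the Cauchy lemma, for an odd sum. -/
theorem isSumFourOctagonal_of_odd {n a b : ℤ} (hn : n = 3 * a - 2 * b) (hb : b % 2 = 1)
    (hb0 : 0 < b) (hm : (4 * a - b ^ 2) % 8 = 3) (hm0 : 0 < 4 * a - b ^ 2)
    (hlt : 3 * a < b ^ 2) : IsSumFourOctagonal n := by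
  obtain ⟨u, v, w, huvw⟩ := isSumThreeSquares_of_mod_eight_eq_three (4 * a - b ^ 2).toNat (by omega)
  rw [Int.toNat_of_nonneg hm0.le] at huvw
  have hodd : ∀ u v w : ZMod 8, u ^ 2 + v ^ 2 + w ^ 2 = 3 → 4 * u = 4 ∧ 4 * v = 4 ∧ 4 * w = 4 := by
    decide
  have hcast : ((u : ZMod 8) ^ 2 + v ^ 2 + w ^ 2 = 3) := by
    have h := (ZMod.intCast_eq_intCast_iff (u ^ 2 + v ^ 2 + w ^ 2) 3 8).mpr
      (by rw [← huvw]; exact hm)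
    exact_mod_cast h
  have hback : ∀ t : ℤ, 4 * (t : ZMod 8) = 4 → t % 2 = 1 := by
    intro t ht
    have h := (ZMod.intCast_eq_intCast_iff (4 * t) 4 8).mp (by exact_mod_cast ht)
    change (4 * t) % 8 = 4 % 8 at h
    omega
  obtain ⟨hu, hv, hw⟩ := hodd _ _ _ hcast
  replace hu := hback u hu
  replace hv := hback v hv
  replace hw := hback w hw
  obtain ⟨w', hw'sq, hw'⟩ : ∃ w' : ℤ, w' ^ 2 = w ^ 2 ∧ (b + u + v + w') % 4 = 0 := by
    by_cases h : (b + u + v + w) % 4 = 0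
    · exact ⟨w, rfl, h⟩
    · exact ⟨-w, by ring, by omega⟩
  rw [← hw'sq] at huvw
  have hlt' : 3 * (u ^ 2 + v ^ 2 + w' ^ 2) < b ^ 2 := by linarith
  have h1 := add_pos_of_three_mul_lt_sq hb0 hlt'
  have h2 := add_pos_of_three_mul_lt_sq (u := u) (v := -v) (w := -w') hb0 (by linarith)
  have h3 := add_pos_of_three_mul_lt_sq (u := -u) (v := v) (w := -w') hb0 (by linarith)
  have h4 := add_pos_of_three_mul_lt_sq (u := -u) (v := -v) (w := w') hb0 (by linarith)
  obtain ⟨x₁, hx₁⟩ : ∃ x, b + u + v + w' = 4 * x := ⟨(b + u + v + w') / 4, by omega⟩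
  obtain ⟨x₂, hx₂⟩ : ∃ x, b + u + -v + -w' = 4 * x := ⟨(b + u + -v + -w') / 4, by omega⟩
  obtain ⟨x₃, hx₃⟩ : ∃ x, b + -u + v + -w' = 4 * x := ⟨(b + -u + v + -w') / 4, by omega⟩
  obtain ⟨x₄, hx₄⟩ : ∃ x, b + -u + -v + w' = 4 * x := ⟨(b + -u + -v + w') / 4, by omega⟩
  refine ⟨x₁, x₂, x₃, x₄, by omega, by omega, by omega, by omega, ?_⟩
  have hs : x₁ + x₂ + x₃ + x₄ = b := by linarith
  have hq : 16 * (x₁ ^ 2 + x₂ ^ 2 + x₃ ^ 2 + x₄ ^ 2) = 16 * a := by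
    have : 16 * (x₁ ^ 2 + x₂ ^ 2 + x₃ ^ 2 + x₄ ^ 2)
      = (4 * x₁) ^ 2 + (4 * x₂) ^ 2 + (4 * x₃) ^ 2 + (4 * x₄) ^ 2 := by ring
    rw [this, ← hx₁, ← hx₂, ← hx₃, ← hx₄]
    linarith
  linarith

/-- A form of the Cauchy lemma, for an even sum. -/
theorem isSumFourOctagonal_of_even {n a b : ℤ} (hn : n = 6 * a - 4 * b)
    (hb0 : 0 < b) (hm : IsSumThreeSquares (2 * a - b ^ 2))
    (hlt : 3 * a < 2 * b ^ 2) : IsSumFourOctagonal n := by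
  obtain ⟨u, v, w, huvw⟩ := hm
  have hpar : (b + u + v + w) % 2 = 0 := by
    have hsq : ∀ t : ℤ, ∃ s, t ^ 2 = t + 2 * s := fun t => by
      obtain ⟨s, hs⟩ := (Int.even_mul_pred_self t).two_dvd
      exact ⟨s, by linarith⟩
    obtain ⟨s₁, h₁⟩ := hsq u
    obtain ⟨s₂, h₂⟩ := hsq v
    obtain ⟨s₃, h₃⟩ := hsq w
    obtain ⟨s₄, h₄⟩ := hsq b
    omega
  have hlt' : 3 * (u ^ 2 + v ^ 2 + w ^ 2) < b ^ 2 := by linarith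
  have h1 := add_pos_of_three_mul_lt_sq hb0 hlt'
  have h2 := add_pos_of_three_mul_lt_sq (u := u) (v := -v) (w := -w) hb0 (by linarith)
  have h3 := add_pos_of_three_mul_lt_sq (u := -u) (v := v) (w := -w) hb0 (by linarith)
  have h4 := add_pos_of_three_mul_lt_sq (u := -u) (v := -v) (w := w) hb0 (by linarith)
  obtain ⟨x₁, hx₁⟩ : ∃ x, b + u + v + w = 2 * x := ⟨(b + u + v + w) / 2, by omega⟩
  obtain ⟨x₂, hx₂⟩ : ∃ x, b + u + -v + -w = 2 * x := ⟨(b + u + -v + -w) / 2, by omega⟩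
  obtain ⟨x₃, hx₃⟩ : ∃ x, b + -u + v + -w = 2 * x := ⟨(b + -u + v + -w) / 2, by omega⟩
  obtain ⟨x₄, hx₄⟩ : ∃ x, b + -u + -v + w = 2 * x := ⟨(b + -u + -v + w) / 2, by omega⟩
  refine ⟨x₁, x₂, x₃, x₄, by omega, by omega, by omega, by omega, ?_⟩
  have hs : x₁ + x₂ + x₃ + x₄ = 2 * b := by linarith
  have hq : 4 * (x₁ ^ 2 + x₂ ^ 2 + x₃ ^ 2 + x₄ ^ 2) = 4 * (2 * a) := by
    have : 4 * (x₁ ^ 2 + x₂ ^ 2 + x₃ ^ 2 + x₄ ^ 2)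
      = (2 * x₁) ^ 2 + (2 * x₂) ^ 2 + (2 * x₃) ^ 2 + (2 * x₄) ^ 2 := by ring
    rw [this, ← hx₁, ← hx₂, ← hx₃, ← hx₄]
    linarith
  linarith

/-- The integer `m` is a sum of four squares of integers prime to three. -/
def IsSumFourSquaresPrimeToThree (m : ℤ) : Prop :=
  ∃ z₁ z₂ z₃ z₄ : ℤ, ¬ 3 ∣ z₁ ∧ ¬ 3 ∣ z₂ ∧ ¬ 3 ∣ z₃ ∧ ¬ 3 ∣ z₄ ∧
    m = z₁ ^ 2 + z₂ ^ 2 + z₃ ^ 2 + z₄ ^ 2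

theorem isSumFourSquaresPrimeToThree_of_isSumThreeSquares {m y : ℤ} (hy : ¬ 3 ∣ y)
    (hmod : (m - y ^ 2) % 9 = 3) (h : IsSumThreeSquares (m - y ^ 2)) :
    IsSumFourSquaresPrimeToThree m := by
  obtain ⟨u, v, w, huvw⟩ := h
  have key : ∀ u v w : ZMod 9, u ^ 2 + v ^ 2 + w ^ 2 = 3 → 3 * u ≠ 0 ∧ 3 * v ≠ 0 ∧ 3 * w ≠ 0 := by
    decide
  have hcast : ((u : ZMod 9) ^ 2 + v ^ 2 + w ^ 2 = 3) := by
    have h := (ZMod.intCast_eq_intCast_iff (u ^ 2 + v ^ 2 + w ^ 2) 3 9).mpr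
      (by rw [← huvw]; exact hmod)
    exact_mod_cast h
  have hback : ∀ t : ℤ, 3 * (t : ZMod 9) ≠ 0 → ¬ 3 ∣ t := by
    rintro _ ht ⟨s, rfl⟩
    apply ht
    have h9 : (9 : ZMod 9) = 0 := rfl
    push_cast
    linear_combination (s : ZMod 9) * h9
  obtain ⟨hu, hv, hw⟩ := key _ _ _ hcast
  exact ⟨y, u, v, w, hy, hback u hu, hback v hv, hback w hw, by linarith⟩

theorem isSumFourSquaresPrimeToThree_of_even (m : ℕ) (h2 : m % 2 = 0) (h3 : m % 3 = 1) :
    IsSumFourSquaresPrimeToThree m := by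
  rcases (by omega : m % 8 = 0 ∨ m % 8 = 4 ∨ m % 4 = 2) with h | h | h
  · obtain ⟨z₁, z₂, z₃, z₄, h₁, h₂, h₃, h₄, hz⟩ :=
      isSumFourSquaresPrimeToThree_of_even (m / 4) (by omega) (by omega)
    refine ⟨2 * z₁, 2 * z₂, 2 * z₃, 2 * z₄, by omega, by omega, by omega, by omega, ?_⟩
    have : (m : ℤ) = 4 * ((m / 4 : ℕ) : ℤ) := by omega
    rw [this, hz]; ring
  · have hred : ∀ y : ℕ, ¬ 3 ∣ y → (m + 8 - y ^ 2 % 8) % 8 = 3 → y ^ 2 ≤ m →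
        (m - y ^ 2) % 9 = 3 → IsSumFourSquaresPrimeToThree m := by
      intro y hy h8 hle h9
      refine isSumFourSquaresPrimeToThree_of_isSumThreeSquares (y := y) (by omega) ?_ ?_
      · rw [← Nat.cast_pow, ← Nat.cast_sub hle]; omega
      · rw [← Nat.cast_pow, ← Nat.cast_sub hle]
        exact isSumThreeSquares_of_mod_eight_eq_three _ (by omega)
    by_cases hlt : m < 49
    · rcases (by omega : m = 4 ∨ m = 28) with rfl | rfl
      · exact ⟨1, 1, 1, 1, by norm_num, by norm_num, by norm_num, by norm_num, by norm_num⟩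
      · exact ⟨5, 1, 1, 1, by norm_num, by norm_num, by norm_num, by norm_num, by norm_num⟩
    rcases (by omega : m % 9 = 4 ∨ m % 9 = 1 ∨ m % 9 = 7) with h9 | h9 | h9
    · exact hred 1 (by omega) (by omega) (by omega) (by omega)
    · exact hred 5 (by omega) (by omega) (by omega) (by omega)
    · exact hred 7 (by omega) (by omega) (by omega) (by omega)
  · have hred : ∀ y : ℕ, ¬ 3 ∣ y → y ^ 2 % 4 = 0 → y ^ 2 ≤ m →
        (m - y ^ 2) % 9 = 3 → IsSumFourSquaresPrimeToThree m := by
      intro y hy h8 hle h9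
      refine isSumFourSquaresPrimeToThree_of_isSumThreeSquares (y := y) (by omega) ?_ ?_
      · rw [← Nat.cast_pow, ← Nat.cast_sub hle]; omega
      · rw [← Nat.cast_pow, ← Nat.cast_sub hle]
        exact isSumThreeSquares_of_mod_four_eq_two _ (by omega)
    rcases (by omega : m % 9 = 7 ∨ m % 9 = 1 ∨ m % 9 = 4) with h9 | h9 | h9
    · exact hred 2 (by omega) (by omega) (by omega) (by omega)
    · by_cases hlt : m < 16
      · obtain rfl : m = 10 := by omega
        exact ⟨2, 2, 1, 1, by norm_num, by norm_num, by norm_num, by norm_num, by norm_num⟩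
      exact hred 4 (by omega) (by omega) (by omega) (by omega)
    · by_cases hlt : m < 64
      · rcases (by omega : m = 22 ∨ m = 58) with rfl | rfl
        · exact ⟨4, 2, 1, 1, by norm_num, by norm_num, by norm_num, by norm_num, by norm_num⟩
        · exact ⟨5, 5, 2, 2, by norm_num, by norm_num, by norm_num, by norm_num, by norm_num⟩
      exact hred 8 (by omega) (by omega) (by omega) (by omega)
termination_by m
decreasing_by omega

theorem isSumFourOctagonal_of_mod_eight_eq_four (n : ℕ) (hn : n % 8 = 4) :
    IsSumFourOctagonal n := by
  obtain ⟨z₁, z₂, z₃, z₄, h₁, h₂, h₃, h₄, hz⟩ :=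
    isSumFourSquaresPrimeToThree_of_even ((3 * n + 4) / 4) (by omega) (by omega)
  have key : ∀ z : ℤ, ¬ 3 ∣ z → ∃ x : ℤ, x ≠ 0 ∧ (3 * x - 1) ^ 2 = 4 * z ^ 2 := by
    intro z hz
    rcases (by omega : z % 3 = 1 ∨ z % 3 = 2) with h | h
    · obtain ⟨x, hx⟩ : ∃ x, 2 * z = 3 * x - 1 := ⟨(2 * z + 1) / 3, by omega⟩
      exact ⟨x, by omega, by rw [← hx]; ring⟩
    · obtain ⟨x, hx⟩ : ∃ x, -(2 * z) = 3 * x - 1 := ⟨(1 - 2 * z) / 3, by omega⟩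
      exact ⟨x, by omega, by rw [← hx]; ring⟩
  obtain ⟨x₁, hx₁, e₁⟩ := key z₁ h₁
  obtain ⟨x₂, hx₂, e₂⟩ := key z₂ h₂
  obtain ⟨x₃, hx₃, e₃⟩ := key z₃ h₃
  obtain ⟨x₄, hx₄, e₄⟩ := key z₄ h₄
  refine ⟨x₁, x₂, x₃, x₄, hx₁, hx₂, hx₃, hx₄, ?_⟩
  have : 3 * (n : ℤ) + 4 = 4 * (((3 * n + 4) / 4 : ℕ) : ℤ) := by omega
  linarith

theorem isSumFourOctagonal_of_large (n : ℕ) (hn : 7000 ≤ n) : IsSumFourOctagonal n := by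
  obtain ⟨t, ht1, ht2, ht⟩ : ∃ t : ℤ, t ^ 2 ≤ n ∧ n < (t + 1) ^ 2 ∧ 83 ≤ t := by
    refine ⟨Nat.sqrt n, by exact_mod_cast Nat.sqrt_le' n, by exact_mod_cast Nat.lt_succ_sqrt' n, ?_⟩
    have : 83 ≤ Nat.sqrt n := Nat.le_sqrt'.mpr (by omega)
    exact_mod_cast this
  have hlow : ∀ b : ℤ, t + 3 ≤ b → n + 2 * b < b ^ 2 := fun b hb => by nlinarith
  have hupp : ∀ b : ℤ, t + 3 ≤ b → b ≤ t + 14 → 3 * b ^ 2 < 4 * (n + 2 * b) := fun b hb hb' => by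
    nlinarith
  have hres : ∀ r : ℤ, ∃ b, t + 3 ≤ b ∧ b ≤ t + 14 ∧ b % 12 = r % 12 := fun r =>
    ⟨t + 3 + (r - t - 3) % 12, by omega, by omega, by omega⟩
  have hsq8 : ∀ c : ℤ, c % 2 = 1 → c ^ 2 % 8 = 1 := fun c hc => by
    obtain ⟨s, hs⟩ := (Int.even_mul_succ_self (c / 2)).two_dvd
    have h : c ^ 2 = 4 * (c / 2 * (c / 2 + 1)) + 1 := by
      obtain ⟨d, rfl⟩ : ∃ d, c = 2 * d + 1 := ⟨c / 2, by omega⟩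
      rw [show (2 * d + 1) / 2 = d by omega]
      ring
    omega
  rcases (by omega : n % 8 = 4 ∨ n % 2 = 1 ∨ n % 4 = 2 ∨ n % 8 = 0) with h | h | h | h
  · exact isSumFourOctagonal_of_mod_eight_eq_four n h
  · obtain ⟨b, hb1, hb2, hb⟩ := hres n
    have h1 := hlow b hb1
    have h2 := hupp b hb1 hb2
    obtain ⟨a, ha⟩ : ∃ a, (n : ℤ) + 2 * b = 3 * a := ⟨(n + 2 * b) / 3, by omega⟩
    have h8 := hsq8 b (by omega)
    exact isSumFourOctagonal_of_odd (a := a) (b := b) (by linarith) (by omega) (by omega)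
      (by omega) (by linarith) (by linarith)
  all_goals
    obtain ⟨b, hb1, hb2, hb⟩ := hres (n + 6)
    have h1 := hlow b hb1
    have h2 := hupp b hb1 hb2
    obtain ⟨c, rfl⟩ : ∃ c, b = 2 * c := ⟨b / 2, by omega⟩
    obtain ⟨a, ha⟩ : ∃ a, (n : ℤ) + 4 * c = 6 * a := ⟨(n + 4 * c) / 6, by omega⟩
    have hpos : 0 < 2 * a - c ^ 2 := by linarith
    refine isSumFourOctagonal_of_even (a := a) (b := c) (by linarith) (by omega) ?_ (by linarith)
    rw [← Int.toNat_of_nonneg hpos.le]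
  · obtain ⟨c', rfl⟩ : ∃ c', c = 2 * c' := ⟨c / 2, by omega⟩
    have : (2 * c') ^ 2 = 4 * c' ^ 2 := by ring
    exact isSumThreeSquares_of_mod_four_eq_two _ (by omega)
  · have h8 := hsq8 c (by omega)
    exact isSumThreeSquares_of_mod_eight_eq_three _ (by omega)

/-! ### Small cases, with finite sets of naturals encoded as bit masks -/

/-- The bit mask of the sums `p + s` with `p` in the list and `s` in the set encoded by `S`. -/
def sumMask (L : List ℕ) (S : ℕ) : ℕ := L.foldr (fun p acc => (S <<< p) ||| acc) 0

theorem exists_of_testBit_sumMask {L : List ℕ} {S n : ℕ} (h : (sumMask L S).testBit n = true) :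
    ∃ p ∈ L, ∃ s, S.testBit s = true ∧ n = p + s := by
  induction L with
  | nil => simp [sumMask] at h
  | cons p L ih =>
    rw [sumMask, List.foldr_cons, Nat.testBit_or, Bool.or_eq_true] at h
    rcases h with h | h
    · rw [Nat.testBit_shiftLeft, Bool.and_eq_true, decide_eq_true_eq] at h
      exact ⟨p, by simp, n - p, h.2, by omega⟩
    · obtain ⟨q, hq, s, hs, he⟩ := ih h
      exact ⟨q, by simp [hq], s, hs, he⟩

/-- The nonzero generalized octagonal numbers with parameter at most `50` in absolute value. -/
def octagonalList : List ℕ :=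
  (List.range 50).flatMap fun i => [3 * i ^ 2 + 4 * i + 1, 3 * i ^ 2 + 8 * i + 5]

theorem exists_of_mem_octagonalList {p : ℕ} (h : p ∈ octagonalList) :
    ∃ x : ℤ, x ≠ 0 ∧ (p : ℤ) = 3 * x ^ 2 - 2 * x := by
  simp only [octagonalList, List.mem_flatMap, List.mem_range, List.mem_cons, List.not_mem_nil,
    or_false] at h
  obtain ⟨i, -, rfl | rfl⟩ := h
  · exact ⟨i + 1, by omega, by push_cast; ring⟩
  · exact ⟨-(i + 1), by omega, by push_cast; ring⟩

theorem sumMask_octagonalList_covers :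
    (sumMask octagonalList (sumMask octagonalList (sumMask octagonalList
      (sumMask octagonalList 1))) ||| 2254575) % 2 ^ 7000 = 2 ^ 7000 - 1 := by
  decide +kernel

theorem isSumFourOctagonal_of_small (n : ℕ) (hn : n < 7000) (h4 : 4 ≤ n)
    (hexc : n ≠ 5 ∧ n ≠ 6 ∧ n ≠ 7 ∧ n ≠ 9 ∧ n ≠ 10 ∧ n ≠ 13 ∧ n ≠ 14 ∧ n ≠ 17 ∧ n ≠ 21) :
    IsSumFourOctagonal n := by
  have h := congrArg (fun m => Nat.testBit m n) sumMask_octagonalList_covers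
  simp only [Nat.testBit_mod_two_pow, Nat.testBit_two_pow_sub_one, hn, decide_true,
    Bool.true_and, Nat.testBit_or, Bool.or_eq_true] at h
  rcases h with h | h
  · obtain ⟨p₁, hp₁, s₁, hs₁, rfl⟩ := exists_of_testBit_sumMask h
    obtain ⟨p₂, hp₂, s₂, hs₂, rfl⟩ := exists_of_testBit_sumMask hs₁
    obtain ⟨p₃, hp₃, s₃, hs₃, rfl⟩ := exists_of_testBit_sumMask hs₂
    obtain ⟨p₄, hp₄, s₄, hs₄, rfl⟩ := exists_of_testBit_sumMask hs₃
    obtain rfl : s₄ = 0 := Nat.testBit_one_eq_true_iff_self_eq_zero.mp hs₄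
    obtain ⟨x₁, hx₁, e₁⟩ := exists_of_mem_octagonalList hp₁
    obtain ⟨x₂, hx₂, e₂⟩ := exists_of_mem_octagonalList hp₂
    obtain ⟨x₃, hx₃, e₃⟩ := exists_of_mem_octagonalList hp₃
    obtain ⟨x₄, hx₄, e₄⟩ := exists_of_mem_octagonalList hp₄
    exact ⟨x₁, x₂, x₃, x₄, hx₁, hx₂, hx₃, hx₄, by push_cast; linarith⟩
  · exfalso
    have hlt : n < 22 := by
      by_contra! hge
      rw [Nat.testBit_lt_two_pow (lt_of_lt_of_le (by norm_num : 2254575 < 2 ^ 22)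
        (Nat.pow_le_pow_right (by norm_num) hge))] at h
      exact Bool.false_ne_true h
    interval_cases n <;> first | omega | exact absurd h (by decide)

/-! ### Any number of summands -/

/-- Every value `3x² - 2x - 1` with `x ≠ 0` lies in the numerical semigroup generated by `4` and
`7`, which consists of the `v` with `7 * (-v % 4) ≤ v`. -/
theorem octagonal_sub_one_mem (x : ℤ) (hx : x ≠ 0) :
    7 * (-(3 * x ^ 2 - 2 * x - 1) % 4) ≤ 3 * x ^ 2 - 2 * x - 1 := by
  by_cases h : 18 ≤ 3 * x ^ 2 - 2 * x - 1
  · omega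
  · have h1 : x < 3 := by by_contra! h'; nlinarith
    have h2 : -3 < x := by by_contra! h'; nlinarith
    interval_cases x <;> simp_all

/-- For `k ≥ 4`, a positive integer `n` is a sum of `k` nonzero generalized octagonal
numbers iff `n ≥ k` and `n ≠ k + b` for every `b ∈ {1, 2, 3, 5, 6, 9, 10, 13, 17}`. -/
theorem stmt_19 (k : ℕ) (hk : 4 ≤ k) (n : ℕ) (hn : 0 < n) :
    (∃ x : Fin k → ℤ, (∀ i, x i ≠ 0) ∧
      (n : ℤ) = ∑ i, (3 * x i ^ 2 - 2 * x i)) ↔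
    (k ≤ n ∧ ∀ b ∈ ({1, 2, 3, 5, 6, 9, 10, 13, 17} : Set ℕ), n ≠ k + b) := by
  constructor
  · rintro ⟨x, hx, hsum⟩
    have h : 7 * (-(∑ i, (3 * x i ^ 2 - 2 * x i - 1)) % 4) ≤ ∑ i, (3 * x i ^ 2 - 2 * x i - 1) :=
      Finset.sum_induction (fun i => 3 * x i ^ 2 - 2 * x i - 1) (fun v : ℤ => 7 * (-v % 4) ≤ v)
        (fun a b ha hb => by
          have : -a / 4 + -b / 4 ≤ -(a + b) / 4 := by omega
          omega) (by simp) (fun i _ => octagonal_sub_one_mem (x i) (hx i))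
    rw [Finset.sum_sub_distrib, ← hsum] at h
    simp only [Finset.sum_const, Finset.card_univ, Fintype.card_fin, nsmul_eq_mul, mul_one] at h
    refine ⟨by omega, fun b hb => ?_⟩
    simp only [Set.mem_insert_iff, Set.mem_singleton_iff] at hb
    rintro rfl
    omega
  · rintro ⟨hkn, hb⟩
    simp only [Set.mem_insert_iff, Set.mem_singleton_iff, forall_eq_or_imp, forall_eq] at hb
    obtain ⟨j, rfl⟩ := Nat.exists_eq_add_of_le hk
    have hrep : IsSumFourOctagonal ((n - j : ℕ) : ℤ) := by
      rcases lt_or_ge (n - j) 7000 with h | h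
      · exact isSumFourOctagonal_of_small _ h (by omega) (by omega)
      · exact isSumFourOctagonal_of_large _ h
    obtain ⟨x₁, x₂, x₃, x₄, h₁, h₂, h₃, h₄, he⟩ := hrep
    refine ⟨Fin.append ![x₁, x₂, x₃, x₄] fun _ => 1, fun i => ?_, ?_⟩
    · refine Fin.addCases (fun i => ?_) (fun i => ?_) i
      · rw [Fin.append_left]
        fin_cases i <;> simpa
      · rw [Fin.append_right]
        exact one_ne_zero
    · rw [Fin.sum_univ_add]
      simp only [Fin.append_left, Fin.append_right, Fin.sum_univ_four, Matrix.cons_val,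
        Finset.sum_const, Finset.card_univ, Fintype.card_fin, nsmul_eq_mul]
      have : (n : ℤ) = ((n - j : ℕ) : ℤ) + j := by omega
      rw [this, he]
      norm_num
end
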